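/- Equation (1): for a finite rooted tree (G, r) on vertex type V, the number of tree isomorphisms from (G, r) to itself equals ∏_{u ∈ V} ∏_{q} (mᵤ(q))!, where the inner product ranges over the distinct rooted-isomorphism classes q of the subtrees rooted at the children of u, and mᵤ(q) is the number of children v of u whose rooted subtree lies in class q. -/

import Mathlib

open scoped Classical

/-- The set of descendants of `u` in the graph `G` rooted at `r`: the vertices
`w` such that `u` lies on a path (hence on the unique path, when `G` is a
tree) from `r` to `w`. -/
def Descendants {V : Type*} (G : SimpleGraph V) (r u : V) : Set V :=
  {w | ∃ p : G.Walk r w, p.IsPath ∧ u ∈ p.support}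

/-- The subtree of `G` (rooted at `r`) rooted at `u`: the induced subgraph on
the descendants of `u`. -/
def Subtree {V : Type*} (G : SimpleGraph V) (r u : V) :
    SimpleGraph (Descendants G r u) :=
  G.induce (Descendants G r u)

/-- Two vertices are equivalent if there is a rooted tree isomorphism between
the subtrees rooted at them, i.e. a graph isomorphism mapping root to root. -/
def SubtreeEquiv {V : Type*} (G : SimpleGraph V) (r : V) (v w : V) : Prop :=
  ∃ φ : Subtree G r v ≃g Subtree G r w,
    ∀ (hv : v ∈ Descendants G r v) (hw : w ∈ Descendants G r w),
      φ ⟨v, hv⟩ = ⟨w, hw⟩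

theorem mem_descendants_self {V : Type*} {G : SimpleGraph V} (hG : G.IsTree)
    (r v : V) : v ∈ Descendants G r v := by
  obtain ⟨p⟩ := hG.isConnected.preconnected r v
  exact ⟨p.toPath, p.toPath.2, SimpleGraph.Walk.end_mem_support _⟩

theorem subtreeEquiv_equivalence {V : Type*} {G : SimpleGraph V}
    (hG : G.IsTree) (r : V) : Equivalence (SubtreeEquiv G r) := by
  constructor
  · intro v
    exact ⟨SimpleGraph.Iso.refl, fun hv hw => rfl⟩
  · rintro v w ⟨φ, hφ⟩
    exact ⟨φ.symm, fun hw hv => by rw [← hφ hv hw, RelIso.symm_apply_apply]⟩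
  · rintro u v w ⟨φ, hφ⟩ ⟨ψ, hψ⟩
    refine ⟨φ.trans ψ, fun hu hw => ?_⟩
    have hv := mem_descendants_self hG r v
    calc (φ.trans ψ) ⟨u, hu⟩ = ψ (φ ⟨u, hu⟩) := rfl
      _ = ⟨w, hw⟩ := by rw [hφ hu hv, hψ hv hw]

/-- The setoid of rooted-isomorphism classes of subtrees. -/
def subtreeSetoid {V : Type*} (G : SimpleGraph V) (hG : G.IsTree) (r : V) :
    Setoid V :=
  ⟨SubtreeEquiv G r, subtreeEquiv_equivalence hG r⟩

/-- The children of `u` in the tree `G` rooted at `r`: the neighbors of `u`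
lying one step further from the root. -/
noncomputable def childrenFinset {V : Type*} [Fintype V] (G : SimpleGraph V)
    (r u : V) : Finset V :=
  Finset.univ.filter fun v => G.Adj u v ∧ G.dist r v = G.dist r u + 1

/-- An order is forest-like when the elements below any given element are pairwise comparable. -/
def IsForestOrder (α : Type*) [LE α] : Prop :=
  ∀ ⦃a b c : α⦄, a ≤ c → b ≤ c → a ≤ b ∨ b ≤ a

namespace IsForestOrder

variable {α β : Type*} [PartialOrder α] [PartialOrder β]

theorem eq_of_covBy_of_le (hα : IsForestOrder α) {v c d x : α} (hc : v ⋖ c) (hd : v ⋖ d)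
    (hcx : c ≤ x) (hdx : d ≤ x) : c = d := by
  rcases hα hcx hdx with h | h
  · exact h.eq_of_not_lt (hd.2 hc.lt)
  · exact (h.eq_of_not_lt (hc.2 hd.lt)).symm

theorem eq_of_covBy_covBy (hα : IsForestOrder α) {a b c : α} (ha : a ⋖ c) (hb : b ⋖ c) :
    a = b := by
  rcases hα ha.le hb.le with h | h
  · exact h.eq_of_not_lt fun h' => ha.2 h' hb.lt
  · exact (h.eq_of_not_lt fun h' => hb.2 h' ha.lt).symm

theorem subtype (hα : IsForestOrder α) (s : Set α) : IsForestOrder s :=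
  fun _ _ _ hac hbc => hα hac hbc

theorem covBy_of_covBy_or_covBy [Finite α] [OrderBot α] [OrderBot β] (hβ : IsForestOrder β)
    (φ : α ≃ β) (hbot : φ ⊥ = ⊥) (hφ : ∀ a b, a ⋖ b → φ a ⋖ φ b ∨ φ b ⋖ φ a) :
    ∀ a b, a ⋖ b → φ a ⋖ φ b := by
  intro a
  induction a using WellFoundedLT.induction with
  | ind a ih =>
    intro b hab
    refine (hφ a b hab).resolve_right fun hba => ?_
    have ha : ⊥ < a := bot_lt_iff_ne_bot.2 fun h => by
      rw [h, hbot] at hba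
      exact not_lt_bot hba.lt
    obtain ⟨c, -, hca⟩ := exists_le_covBy_of_lt ha
    have hcb : c = b := φ.injective (hβ.eq_of_covBy_covBy (ih c hca.lt a hca) hba)
    exact (hca.lt.trans hab.lt).ne hcb

/-- A bijection between finite rooted forest orders that fixes the root and preserves the
undirected Hasse diagram is monotone. -/
theorem monotone_of_covBy_or_covBy [Finite α] [OrderBot α] [OrderBot β] (hβ : IsForestOrder β)
    (φ : α ≃ β) (hbot : φ ⊥ = ⊥) (hφ : ∀ a b, a ⋖ b → φ a ⋖ φ b ∨ φ b ⋖ φ a) :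
    Monotone φ := by
  have := Fintype.ofFinite α
  let _ : LocallyFiniteOrder α := Fintype.toLocallyFiniteOrder
  exact (monotone_iff_forall_covBy _).2 fun a b h =>
    (hβ.covBy_of_covBy_or_covBy φ hbot hφ a b h).le

/-- An isomorphism of the undirected Hasse diagrams of finite rooted forest orders that fixes the
root is an order isomorphism. -/
theorem le_iff_le_of_covBy_or_covBy [Finite α] [Finite β] [OrderBot α] [OrderBot β]
    (hα : IsForestOrder α) (hβ : IsForestOrder β) (φ : α ≃ β) (hbot : φ ⊥ = ⊥)
    (hφ : ∀ a b, (φ a ⋖ φ b ∨ φ b ⋖ φ a) ↔ (a ⋖ b ∨ b ⋖ a)) (a b : α) :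
    φ a ≤ φ b ↔ a ≤ b := by
  refine ⟨fun h => ?_, fun h => hβ.monotone_of_covBy_or_covBy φ hbot
    (fun a b hab => (hφ a b).2 (Or.inl hab)) h⟩
  have := hα.monotone_of_covBy_or_covBy φ.symm (by rw [← hbot, φ.symm_apply_apply])
    (fun a b hab => (hφ _ _).1 (by simpa using Or.inl hab)) h
  simpa using this

/-- Isomorphisms between the up-sets of the elements covering `v` and those of the elements
covering `w` glue to an isomorphism between the up-sets of `v` and `w`. -/
theorem exists_orderIso_Ici [Finite α] (hα : IsForestOrder α) {v w : α}
    (σ : {c // v ⋖ c} ≃ {c // w ⋖ c}) (e : ∀ c : {c // v ⋖ c}, Set.Ici c.1 ≃o Set.Ici (σ c).1) :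
    ∃ φ : Set.Ici v ≃o Set.Ici w, ∀ (c : {c // v ⋖ c}) (x : Set.Ici c.1),
      (φ ⟨x, c.2.le.trans x.2⟩ : α) = e c x := by
  let f (x : α) : α := if h : ∃ c : {c // v ⋖ c}, c.1 ≤ x
    then e h.choose ⟨x, h.choose_spec⟩ else w
  have hf (c : {c // v ⋖ c}) (x : α) (hx : c.1 ≤ x) : f x = e c ⟨x, hx⟩ := by
    have h : ∃ c : {c // v ⋖ c}, c.1 ≤ x := ⟨c, hx⟩
    have hc : h.choose = c :=
      Subtype.ext (hα.eq_of_covBy_of_le h.choose.2 c.2 h.choose_spec hx)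
    simp only [f, dif_pos h]
    generalize_proofs h'
    revert h'
    rw [hc]
    exact fun _ => rfl
  have hfv : f v = w := dif_neg fun ⟨c, hc⟩ => c.2.lt.not_ge hc
  have hcases (u x : α) (hx : u ≤ x) : x = u ∨ ∃ c : {c // u ⋖ c}, c.1 ≤ x := by
    rcases hx.eq_or_lt with h | h
    · exact Or.inl h.symm
    · obtain ⟨c, hc, hcx⟩ := exists_covBy_le_of_lt h
      exact Or.inr ⟨⟨c, hc⟩, hcx⟩
  have hσf (c : {c // v ⋖ c}) (x : α) (hx : c.1 ≤ x) : (σ c).1 ≤ f x := by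
    rw [hf c x hx]
    exact (e c ⟨x, hx⟩).2
  have hwf (x : α) (hx : v ≤ x) : w ≤ f x := by
    rcases hcases v x hx with rfl | ⟨c, hc⟩
    · exact hfv.ge
    · exact (σ c).2.le.trans (hσf c x hc)
  have hle (x y : α) (hx : v ≤ x) (hy : v ≤ y) : f x ≤ f y ↔ x ≤ y := by
    rcases hcases v x hx with rfl | ⟨c, hc⟩
    · simp only [hfv, hwf y hy, hy]
    rcases hcases v y hy with rfl | ⟨d, hd⟩
    · rw [hfv]
      exact iff_of_false ((σ c).2.lt.trans_le (hσf c x hc)).not_ge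
        (c.2.lt.trans_le hc).not_ge
    by_cases hcd : c = d
    · subst hcd
      rw [hf c x hc, hf c y hd, Subtype.coe_le_coe, OrderIso.le_iff_le]
      exact Iff.rfl
    · refine iff_of_false (fun h => hcd (σ.injective (Subtype.ext ?_)))
        (fun h => hcd (Subtype.ext ?_))
      · exact hα.eq_of_covBy_of_le (σ c).2 (σ d).2 ((hσf c x hc).trans h) (hσf d y hd)
      · exact hα.eq_of_covBy_of_le c.2 d.2 (hc.trans h) hd
  let F : Set.Ici v ↪o Set.Ici w :=
    OrderEmbedding.ofMapLEIff (fun x => ⟨f x, hwf x x.2⟩) fun x y => hle x y x.2 y.2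
  have hF : Function.Surjective F := by
    rintro ⟨y, hy⟩
    rcases hcases w y hy with rfl | ⟨d, hd⟩
    · exact ⟨⟨v, le_rfl⟩, Subtype.ext hfv⟩
    · obtain ⟨c, rfl⟩ := σ.surjective d
      obtain ⟨x, hx⟩ := (e c).surjective ⟨y, hd⟩
      refine ⟨⟨x, c.2.le.trans x.2⟩, Subtype.ext ?_⟩
      change f x = y
      rw [hf c x x.2, Subtype.coe_eta, hx]
  exact ⟨RelIso.ofSurjective F hF, fun c x => hf c x x.2⟩

theorem covBy_Ici_iff {v : α} (x y : Set.Ici v) : x ⋖ y ↔ x.1 ⋖ y.1 := by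
  refine (Set.OrdConnected.apply_covBy_apply_iff (OrderEmbedding.subtype (· ∈ Set.Ici v)) ?_).symm
  rw [OrderEmbedding.coe_subtype, Subtype.range_coe_subtype]
  exact Set.ordConnected_Ici

theorem covBy_apply_Ici {v : α} (φ : Set.Ici v ≃o Set.Ici v) (c : {c // v ⋖ c}) :
    v ⋖ (φ ⟨c, c.2.le⟩ : α) := by
  have h : (⊥ : Set.Ici v) ⋖ ⟨c, c.2.le⟩ := (covBy_Ici_iff _ _).2 c.2
  have h' := (apply_covBy_apply_iff φ).2 h
  rw [map_bot] at h'
  exact (covBy_Ici_iff _ _).1 h'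

/-- The permutation of the elements covering `v` induced by an automorphism of the up-set
of `v`. -/
noncomputable def permCovBy [Finite α] {v : α} (φ : Set.Ici v ≃o Set.Ici v) :
    Equiv.Perm {c // v ⋖ c} :=
  Equiv.ofBijective (fun c => ⟨φ ⟨c, c.2.le⟩, covBy_apply_Ici φ c⟩) <|
    Finite.injective_iff_bijective.1 fun c d h => by
      have h' : φ ⟨c, c.2.le⟩ = φ ⟨d, d.2.le⟩ := Subtype.ext (Subtype.mk.inj h)
      exact Subtype.ext (Subtype.mk.inj (φ.injective h'))

/-- The restriction of an automorphism of the up-set of `v` to the up-set of an element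
covering `v`. -/
def restrictIci {v : α} (φ : Set.Ici v ≃o Set.Ici v) (c d : {c // v ⋖ c})
    (h : (φ ⟨c, c.2.le⟩ : α) = d) : Set.Ici c.1 ≃o Set.Ici d.1 where
  toFun x := ⟨φ ⟨x, c.2.le.trans x.2⟩, h.symm.le.trans (φ.monotone (show c.1 ≤ x from x.2))⟩
  invFun y := ⟨φ.symm ⟨y, d.2.le.trans y.2⟩, by
    have : φ ⟨c, c.2.le⟩ ≤ ⟨y, d.2.le.trans y.2⟩ := h.le.trans y.2
    exact φ.le_symm_apply.2 this⟩
  left_inv x := Subtype.ext (congrArg (fun z : Set.Ici v => (z : α))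
    (φ.symm_apply_apply ⟨x, c.2.le.trans x.2⟩))
  right_inv y := Subtype.ext (congrArg (fun z : Set.Ici v => (z : α))
    (φ.apply_symm_apply ⟨y, d.2.le.trans y.2⟩))
  map_rel_iff' := φ.le_iff_le

theorem card_permCovBy_fiber [Finite α] (hα : IsForestOrder α) {v : α}
    (σ : Equiv.Perm {c // v ⋖ c}) :
    Nat.card {φ : Set.Ici v ≃o Set.Ici v // permCovBy φ = σ} =
      Nat.card (∀ c : {c // v ⋖ c}, Set.Ici c.1 ≃o Set.Ici (σ c).1) := by
  have hval (φ : Set.Ici v ≃o Set.Ici v) (h : permCovBy φ = σ) (c : {c // v ⋖ c}) :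
      (φ ⟨c, c.2.le⟩ : α) = σ c := by
    rw [← h]
    rfl
  refine Nat.card_congr (Equiv.ofBijective
    (fun φ c => restrictIci φ.1 c (σ c) (hval φ.1 φ.2 c)) ⟨fun φ ψ h => ?_, fun e => ?_⟩)
  · refine Subtype.ext (RelIso.ext fun x => ?_)
    rcases (show v ≤ x from x.2).eq_or_lt with hx | hx
    · have : x = ⊥ := Subtype.ext hx.symm
      rw [this, map_bot, map_bot]
    · obtain ⟨c, hc, hcx⟩ := exists_covBy_le_of_lt hx
      have := congrArg (fun f => f ⟨x, hcx⟩) (congrFun h ⟨c, hc⟩)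
      exact Subtype.ext (Subtype.mk.inj this)
  · obtain ⟨φ, hφ⟩ := hα.exists_orderIso_Ici σ e
    refine ⟨⟨φ, Equiv.ext fun c => Subtype.ext ((hφ c ⟨c, le_rfl⟩).trans ?_)⟩, ?_⟩
    · exact congrArg Subtype.val (map_bot (e c))
    · exact funext fun c => RelIso.ext fun x => Subtype.ext (hφ c x)

/-- The permutations of the elements covering `v` that preserve the isomorphism type of the
up-sets. -/
abbrev CovByPerm (v : α) : Type _ :=
  {σ : Equiv.Perm {c // v ⋖ c} // ∀ c, Nonempty (Set.Ici c.1 ≃o Set.Ici (σ c).1)}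

theorem card_Ici_orderIso [Fintype α] (hα : IsForestOrder α) (v : α) :
    Nat.card (Set.Ici v ≃o Set.Ici v) =
      Nat.card (CovByPerm v) * ∏ c : {c // v ⋖ c}, Nat.card (Set.Ici c.1 ≃o Set.Ici c.1) := by
  have hfiber (σ : Equiv.Perm {c // v ⋖ c}) :
      Nat.card (∀ c : {c // v ⋖ c}, Set.Ici c.1 ≃o Set.Ici (σ c).1) =
        if ∀ c, Nonempty (Set.Ici c.1 ≃o Set.Ici (σ c).1) then
          ∏ c : {c // v ⋖ c}, Nat.card (Set.Ici c.1 ≃o Set.Ici c.1) else 0 := by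
    rw [Nat.card_pi]
    split_ifs with h
    · refine Finset.prod_congr rfl fun c _ => ?_
      obtain ⟨e⟩ := h c
      exact Nat.card_congr ⟨fun f => f.trans e.symm, fun f => f.trans e,
        fun f => RelIso.ext fun x => e.apply_symm_apply _,
        fun f => RelIso.ext fun x => e.symm_apply_apply _⟩
    · push Not at h
      obtain ⟨c, hc⟩ := h
      exact Finset.prod_eq_zero (Finset.mem_univ c) Nat.card_of_isEmpty
  have : Finite (Set.Ici v ≃o Set.Ici v) := DFunLike.finite _
  rw [← Nat.card_congr (Equiv.sigmaFiberEquiv (permCovBy (v := v))), Nat.card_sigma]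
  simp only [hα.card_permCovBy_fiber, hfiber]
  rw [← Finset.sum_filter, Finset.sum_const, smul_eq_mul, Nat.card_eq_fintype_card,
    Fintype.card_subtype]

theorem card_Ici_orderIso_eq_prod [Fintype α] (hα : IsForestOrder α) (v : α) :
    Nat.card (Set.Ici v ≃o Set.Ici v) =
      ∏ u ∈ Finset.univ.filter (v ≤ ·), Nat.card (CovByPerm u) := by
  induction v using WellFoundedGT.induction with
  | ind v ih =>
    have hdisj : Set.PairwiseDisjoint
        ((Finset.univ : Finset {c // v ⋖ c}) : Set {c // v ⋖ c})
        fun c => Finset.univ.filter (c.1 ≤ ·) := by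
      intro c _ d _ hcd
      refine Finset.disjoint_left.2 fun x hc hd => hcd (Subtype.ext ?_)
      exact hα.eq_of_covBy_of_le c.2 d.2 (Finset.mem_filter.1 hc).2 (Finset.mem_filter.1 hd).2
    have hunion : Finset.univ.filter (v ≤ ·) = insert v
        ((Finset.univ : Finset {c // v ⋖ c}).biUnion fun c => Finset.univ.filter (c.1 ≤ ·)) := by
      ext x
      simp only [Finset.mem_filter, Finset.mem_univ, true_and, Finset.mem_insert,
        Finset.mem_biUnion]
      refine ⟨fun h => h.eq_or_lt.imp Eq.symm fun h => ?_, ?_⟩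
      · obtain ⟨c, hc, hcx⟩ := exists_covBy_le_of_lt h
        exact ⟨⟨c, hc⟩, hcx⟩
      · rintro (rfl | ⟨c, hc⟩)
        exacts [le_rfl, c.2.le.trans hc]
    rw [hα.card_Ici_orderIso, hunion, Finset.prod_insert, Finset.prod_biUnion hdisj]
    · exact congrArg _ (Finset.prod_congr rfl fun c _ => ih c c.2.lt)
    · simp only [Finset.mem_biUnion, Finset.mem_filter, Finset.mem_univ, true_and, not_exists]
      exact fun c => c.2.lt.not_ge

/-- The number of automorphisms of a finite rooted forest order is a product, over all elements,
of the number of permutations of the covering elements preserving isomorphism types. -/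
theorem card_orderIso_eq_prod [Fintype α] [OrderBot α] (hα : IsForestOrder α) :
    Nat.card (α ≃o α) = ∏ u : α, Nat.card (CovByPerm u) := by
  have h := hα.card_Ici_orderIso_eq_prod ⊥
  simp only [bot_le, Finset.filter_true] at h
  rw [← h]
  let e : Set.Ici (⊥ : α) ≃o α :=
    (OrderIso.setCongr _ _ Set.Ici_bot).trans OrderIso.Set.univ
  exact Nat.card_congr ⟨fun f => (e.trans f).trans e.symm, fun f => (e.symm.trans f).trans e,
    fun f => RelIso.ext fun x => by simp, fun f => RelIso.ext fun x => by simp⟩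

/-- The permutations preserving isomorphism types of up-sets, counted by the classes of a setoid
describing these isomorphism types. -/
theorem card_covByPerm [Fintype α] (s : Setoid α)
    (hs : ∀ c d, s c d ↔ Nonempty (Set.Ici c ≃o Set.Ici d)) (u : α) (C : Finset α)
    (hC : ∀ c, c ∈ C ↔ u ⋖ c) :
    Nat.card (CovByPerm u) = ∏ q ∈ C.image (Quotient.mk s),
      Nat.factorial (C.filter (fun c => Quotient.mk s c = q)).card := by
  let f (c : {c // u ⋖ c}) : Quotient s := Quotient.mk s c
  have h (σ : Equiv.Perm {c // u ⋖ c}) :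
      (∀ c, Nonempty (Set.Ici c.1 ≃o Set.Ici (σ c).1)) ↔ f ∘ σ = f := by
    rw [funext_iff]
    refine forall_congr' fun c => ?_
    rw [← hs, ← Quotient.eq]
    exact eq_comm
  rw [Nat.card_congr (Equiv.subtypeEquivRight h), Nat.card_eq_fintype_card,
    DomMulAct.stabilizer_card' f]
  have himage : Finset.univ.image f = C.image (Quotient.mk s) := by
    ext q
    simp [f, hC]
  rw [himage]
  refine Finset.prod_congr rfl fun q _ => congrArg _ ?_
  rw [Fintype.card_subtype]
  refine Finset.card_bij (fun c _ => c.1) ?_ (fun _ _ _ _ => Subtype.ext) ?_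
  · intro c hc
    exact Finset.mem_filter.2 ⟨(hC _).2 c.2, (Finset.mem_filter.1 hc).2⟩
  · intro c hc
    rw [Finset.mem_filter, hC] at hc
    exact ⟨⟨c, hc.1⟩, Finset.mem_filter.2 ⟨Finset.mem_univ _, hc.2⟩, rfl⟩

end IsForestOrder

section TreeOrder

variable {V : Type*} {G : SimpleGraph V}

theorem mem_descendants_iff_mem_support (hG : G.IsTree) {r a b : V} {p : G.Walk r b}
    (hp : p.IsPath) : b ∈ Descendants G r a ↔ a ∈ p.support := by
  refine ⟨fun ⟨q, hq, ha⟩ => ?_, fun ha => ⟨p, hp, ha⟩⟩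
  rwa [(hG.existsUnique_path r b).unique hp hq]

theorem dist_lt_of_mem_descendants (hG : G.IsTree) {r a b : V} (h : b ∈ Descendants G r a)
    (hne : a ≠ b) : G.dist r a < G.dist r b := by
  obtain ⟨p, hp⟩ := hG.connected.exists_walk_length_eq_dist r b
  have ha := (mem_descendants_iff_mem_support hG (p.isPath_of_length_eq_dist hp)).1 h
  have hlen := congrArg SimpleGraph.Walk.length (p.take_spec ha)
  rw [SimpleGraph.Walk.length_append, hp] at hlen
  have h1 := SimpleGraph.dist_le (p.takeUntil a ha)
  have h2 := SimpleGraph.dist_le (p.dropUntil a ha)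
  have h3 := hG.connected.pos_dist_of_ne hne
  lia

theorem mem_descendants_trans (hG : G.IsTree) {r a b c : V} (hab : b ∈ Descendants G r a)
    (hbc : c ∈ Descendants G r b) : c ∈ Descendants G r a := by
  obtain ⟨p, hp, hb⟩ := hbc
  exact ⟨p, hp, p.support_takeUntil_subset_support hb
    ((mem_descendants_iff_mem_support hG (hp.takeUntil hb)).1 hab)⟩

theorem getVert_mem_descendants_getVert {r b : V} {p : G.Walk r b} (hp : p.IsPath) {i j : ℕ}
    (hij : i ≤ j) : p.getVert j ∈ Descendants G r (p.getVert i) := by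
  refine ⟨p.take j, hp.take j, ?_⟩
  have := (p.take j).getVert_mem_support i
  rwa [SimpleGraph.Walk.take_getVert, min_eq_right hij] at this

/-- The ancestor order of a rooted tree: `a ≤ b` when `a` lies on the path from the root
to `b`. -/
abbrev treeOrder (hG : G.IsTree) (r : V) : PartialOrder V where
  le a b := b ∈ Descendants G r a
  le_refl a := mem_descendants_self hG r a
  le_trans _ _ _ := mem_descendants_trans hG
  le_antisymm a b hab hba := by
    by_contra hne
    exact (dist_lt_of_mem_descendants hG hab hne).asymm
      (dist_lt_of_mem_descendants hG hba (Ne.symm hne))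

/-- The root is the least element of the ancestor order. -/
abbrev treeOrderBot (hG : G.IsTree) (r : V) :
    letI := treeOrder hG r
    OrderBot V :=
  letI := treeOrder hG r
  { bot := r
    bot_le := fun a => by
      obtain ⟨p, hp, -⟩ := mem_descendants_self hG r a
      exact ⟨p, hp, p.start_mem_support⟩ }

theorem isForestOrder_treeOrder (hG : G.IsTree) (r : V) :
    letI := treeOrder hG r
    IsForestOrder V := by
  rintro a b c ⟨p, hp, ha⟩ hb
  rw [SimpleGraph.Walk.mem_support_iff_exists_getVert] at ha
  obtain ⟨i, rfl, -⟩ := ha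
  obtain ⟨j, rfl, -⟩ := SimpleGraph.Walk.mem_support_iff_exists_getVert.1
    ((mem_descendants_iff_mem_support hG hp).1 hb)
  exact (le_total i j).imp (getVert_mem_descendants_getVert hp)
    (getVert_mem_descendants_getVert hp)

theorem covBy_treeOrder_iff (hG : G.IsTree) (r u v : V) :
    letI := treeOrder hG r
    u ⋖ v ↔ G.Adj u v ∧ G.dist r v = G.dist r u + 1 := by
  let _ := treeOrder hG r
  have hlt {a b : V} (h : a < b) : G.dist r a < G.dist r b :=
    dist_lt_of_mem_descendants hG h.le h.ne
  constructor
  · intro h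
    obtain ⟨p, hp, hu⟩ := h.le
    have hnil : ¬ p.Nil := by
      intro hnil
      have : p.support = [r] := SimpleGraph.Walk.nil_iff_support_eq.1 hnil
      rw [this, List.mem_singleton] at hu
      exact h.ne (hu.trans hnil.eq)
    have hadj := p.adj_penultimate hnil
    have hupen : u ∈ p.dropLast.support := by
      rw [← p.concat_dropLast hadj, SimpleGraph.Walk.support_concat, List.mem_append,
        List.mem_singleton] at hu
      exact hu.resolve_right h.ne
    have hle : u ≤ p.penultimate := ⟨_, hp.dropLast, hupen⟩
    have hpen : p.penultimate < v :=
      lt_of_le_of_ne ⟨p, hp, p.getVert_mem_support _⟩ hadj.ne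
    rw [← hle.eq_of_not_lt fun h' => h.2 h' hpen] at hadj
    refine ⟨hadj, (hG.dist_eq_dist_add_one_of_adj r hadj).resolve_left fun h' => ?_⟩
    have := hlt h.lt
    lia
  · rintro ⟨hadj, hdist⟩
    obtain ⟨p, hp, -⟩ := mem_descendants_self hG r u
    have hv : v ∉ p.support := fun hv => by
      have := dist_lt_of_mem_descendants hG ⟨p, hp, hv⟩ hadj.ne'
      lia
    have huv : u < v := lt_of_le_of_ne
      ⟨p.concat hadj, hp.concat hv hadj,
        p.support_subset_support_concat hadj p.end_mem_support⟩ hadj.ne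
    refine ⟨huv, fun x hux hxv => ?_⟩
    have h1 := hlt hux
    have h2 := hlt hxv
    lia

theorem adj_iff_covBy_or_covBy (hG : G.IsTree) (r u v : V) :
    letI := treeOrder hG r
    G.Adj u v ↔ u ⋖ v ∨ v ⋖ u := by
  rw [covBy_treeOrder_iff, covBy_treeOrder_iff]
  refine ⟨fun h => ?_, fun h => h.elim And.left fun h => h.1.symm⟩
  rcases hG.dist_eq_dist_add_one_of_adj r h with h' | h'
  · exact Or.inr ⟨h.symm, h'⟩
  · exact Or.inl ⟨h, h'⟩

theorem subtreeEquiv_iff_nonempty_orderIso [Finite V] (hG : G.IsTree) (r c d : V) :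
    letI := treeOrder hG r
    SubtreeEquiv G r c d ↔ Nonempty (Set.Ici c ≃o Set.Ici d) := by
  let _ := treeOrder hG r
  have hV : IsForestOrder V := isForestOrder_treeOrder hG r
  have hc : Set.Ici c = Descendants G r c := rfl
  have hd : Set.Ici d = Descendants G r d := rfl
  constructor
  · rintro ⟨φ, hφ⟩
    let ψ : Set.Ici c ≃ Set.Ici d :=
      ((Equiv.setCongr hc).trans φ.toEquiv).trans (Equiv.setCongr hd.symm)
    refine ⟨⟨ψ, fun {a b} => (hV.subtype _).le_iff_le_of_covBy_or_covBy (hV.subtype _) ψ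
      (hφ _ (mem_descendants_self hG r d)) (fun a b => ?_) a b⟩⟩
    simp only [IsForestOrder.covBy_Ici_iff, ← adj_iff_covBy_or_covBy hG r]
    exact φ.map_adj_iff (v := a) (w := b)
  · rintro ⟨e⟩
    have hcov (a b : Set.Ici c) : (e a : V) ⋖ e b ↔ a.1 ⋖ b.1 := by
      rw [← IsForestOrder.covBy_Ici_iff, ← IsForestOrder.covBy_Ici_iff, apply_covBy_apply_iff]
    have hadj (a b : Set.Ici c) : G.Adj (e a) (e b) ↔ G.Adj a b := by
      rw [adj_iff_covBy_or_covBy hG r, adj_iff_covBy_or_covBy hG r, hcov, hcov]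
    exact ⟨⟨e.toEquiv, fun {a b} => hadj a b⟩, fun _ _ => map_bot e⟩

theorem card_rooted_automorphisms_eq_card_orderIso [Finite V] (hG : G.IsTree) (r : V) :
    letI := treeOrder hG r
    Nat.card {φ : G ≃g G // φ r = r} = Nat.card (V ≃o V) := by
  let _ := treeOrder hG r
  let _ := treeOrderBot hG r
  have hV : IsForestOrder V := isForestOrder_treeOrder hG r
  refine Nat.card_congr ⟨fun φ => ⟨φ.1.toEquiv, fun {a b} =>
    hV.le_iff_le_of_covBy_or_covBy hV φ.1.toEquiv φ.2 (fun a b => ?_) a b⟩,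
    fun e => ⟨⟨e.toEquiv, fun {a b} => ?_⟩, map_bot e⟩, fun _ => rfl, fun _ => rfl⟩
  · rw [← adj_iff_covBy_or_covBy hG r, ← adj_iff_covBy_or_covBy hG r]
    exact φ.1.map_adj_iff
  · rw [adj_iff_covBy_or_covBy hG r, adj_iff_covBy_or_covBy hG r]
    exact or_congr (apply_covBy_apply_iff e) (apply_covBy_apply_iff e)

end TreeOrder

theorem card_rooted_automorphisms_eq_prod_factorials {V : Type*} [Fintype V]
    (G : SimpleGraph V) (hG : G.IsTree) (r : V) :
    Nat.card {φ : G ≃g G // φ r = r} =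
      ∏ u : V,
        ∏ q ∈ (childrenFinset G r u).image (Quotient.mk (subtreeSetoid G hG r)),
          Nat.factorial ((childrenFinset G r u).filter
            (fun v => Quotient.mk (subtreeSetoid G hG r) v = q)).card := by
  let _ := treeOrder hG r
  let _ := treeOrderBot hG r
  rw [card_rooted_automorphisms_eq_card_orderIso hG r,
    (isForestOrder_treeOrder hG r).card_orderIso_eq_prod]
  refine Finset.prod_congr rfl fun u _ => IsForestOrder.card_covByPerm _
    (fun c d => subtreeEquiv_iff_nonempty_orderIso hG r c d) u _ fun c => ?_
  rw [covBy_treeOrder_iff, childrenFinset, Finset.mem_filter]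
  exact and_iff_right (Finset.mem_univ c)
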